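/- (Termination of the rewrite-basis algorithm) There is no infinite sequence a_0, a_1, a_2, … of elements of R^m satisfying all of the following: (i) ‾a_i ≠ 0 for every i; (ii) 𝔰(a_i) ≺_t 𝔰(a_j) whenever i < j; (iii) for every i, either there is some j ∈ {1,…,m} with f_j ≠ 0, 𝔰(a_i) = e_j and lp(‾a_i) ⪯ lp(f_j), or there are indices j, k such that a_j and a_k give rise to a regular S-pair with ‾(spair(a_j,a_k)) ≠ 0, 𝔰(a_i) = 𝔰(spair(a_j,a_k)) and lp(‾a_i) ⪯ lp(‾(spair(a_j,a_k))); (iv) for every i, a_i admits no regular s-reduction step modulo {a_0,…,a_{i−1}}; and (v) for every i, the set {a_0,…,a_{i−1}} is a signature Gröbner basis up to 𝔰(a_i). -/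

import Mathlib

namespace SigGB

noncomputable section

/-- Power-products in `n` indeterminates, written additively as exponent vectors
(so the power-product `1` is `0`, and multiplication of power-products is `+`). -/
abbrev PP (n : ℕ) : Type := Fin n →₀ ℕ

/-- Terms: a power-product together with a component index (`t·e_i ↝ (t, i)`). -/
abbrev Term (n m : ℕ) : Type := PP n × Fin m

/-- Multiplication of a term by a power-product: `t ⊗ (s·e_i) = (t·s)·e_i`. -/
def mulTerm {n m : ℕ} (t : PP n) (u : Term n m) : Term n m := (t + u.1, u.2)

/-- Divisibility of terms: `u ∣ v` iff `v = t ⊗ u` for some power-product `t`. -/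
def termDvd {n m : ℕ} (u v : Term n m) : Prop := ∃ t : PP n, v = mulTerm t u

/-- Componentwise lcm of power-products. -/
noncomputable def lcmPP {n : ℕ} (s t : PP n) : PP n := Finsupp.zipWith max (max_self 0) s t

/-- Strict part of a relation. -/
def strict {α : Type*} (r : α → α → Prop) (x y : α) : Prop := r x y ∧ x ≠ y

/-- `ple` is an admissible order on power-products and `tle` is a compatible
linear order on terms. -/
structure OrdersOK {n m : ℕ} (ple : PP n → PP n → Prop)
    (tle : Term n m → Term n m → Prop) : Prop where
  ple_refl : ∀ t, ple t t
  ple_trans : ∀ s t u, ple s t → ple t u → ple s u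
  ple_antisymm : ∀ s t, ple s t → ple t s → s = t
  ple_total : ∀ s t, ple s t ∨ ple t s
  ple_one_le : ∀ t, ple 0 t
  ple_mul : ∀ (t s₁ s₂ : PP n), ple s₁ s₂ → ple (t + s₁) (t + s₂)
  tle_refl : ∀ u, tle u u
  tle_trans : ∀ u v w, tle u v → tle v w → tle u w
  tle_antisymm : ∀ u v, tle u v → tle v u → u = v
  tle_total : ∀ u v, tle u v ∨ tle v u
  tle_mul : ∀ (t : PP n) (u v : Term n m), tle u v → tle (mulTerm t u) (mulTerm t v)
  tle_compat : ∀ (s t : PP n) (i j : Fin m), ple s t → i ≤ j → tle (s, i) (t, j)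

variable {K : Type*} [Field K] {n m : ℕ} [NeZero m]

variable (f : Fin m → MvPolynomial (Fin n) K)
variable (ple : PP n → PP n → Prop)
variable (tle : Term n m → Term n m → Prop)

/-- The module homomorphism `R^m → R` determined by `e_i ↦ f i`, i.e. `a ↦ ‾a`. -/
def bar (a : Fin m → MvPolynomial (Fin n) K) : MvPolynomial (Fin n) K := ∑ i, a i * f i

/-- Multiplication of a module element by a coefficient `c` and a power-product `t`. -/
noncomputable def monomMul (c : K) (t : PP n) (a : Fin m → MvPolynomial (Fin n) K) :
    Fin m → MvPolynomial (Fin n) K :=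
  fun i => MvPolynomial.monomial t c * a i

/-- The coefficient of a term in a module element. -/
def coeffM (a : Fin m → MvPolynomial (Fin n) K) (u : Term n m) : K :=
  MvPolynomial.coeff u.1 (a u.2)

open Classical in
/-- Leading power-product of a polynomial w.r.t. `ple`
(junk value `0`, i.e. the power-product `1`, for the zero polynomial). -/
noncomputable def lp (p : MvPolynomial (Fin n) K) : PP n :=
  if h : ∃ t, MvPolynomial.coeff t p ≠ 0 ∧ ∀ s, MvPolynomial.coeff s p ≠ 0 → ple s t
  then h.choose else 0

/-- Leading coefficient of a polynomial w.r.t. `ple`. -/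
noncomputable def lc (p : MvPolynomial (Fin n) K) : K := MvPolynomial.coeff (lp ple p) p

open Classical in
/-- Signature of a module element: its `tle`-largest term with nonzero coefficient
(junk value for `0`). -/
noncomputable def sig (a : Fin m → MvPolynomial (Fin n) K) : Term n m :=
  if h : ∃ u, coeffM a u ≠ 0 ∧ ∀ v, coeffM a v ≠ 0 → tle v u
  then h.choose else ((0 : PP n), (0 : Fin m))

/-- Leading coefficient of a module element. -/
noncomputable def lcM (a : Fin m → MvPolynomial (Fin n) K) : K := coeffM a (sig tle a)

/-- One-step s-reduction of `a` to `b` modulo `G`, witnessed by `g ∈ G` and the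
power-product `t`. -/
def RedStepWith (G : Set (Fin m → MvPolynomial (Fin n) K))
    (a b g : Fin m → MvPolynomial (Fin n) K) (t : PP n) : Prop :=
  g ∈ G ∧ bar f g ≠ 0 ∧
    MvPolynomial.coeff (t + lp ple (bar f g)) (bar f a) ≠ 0 ∧
    b = a - monomMul (MvPolynomial.coeff (t + lp ple (bar f g)) (bar f a) / lc ple (bar f g)) t g ∧
    tle (mulTerm t (sig tle g)) (sig tle a)

/-- The step witnessed by `g` and `t` is regular: `t ⊗ 𝔰(g) ≺_t 𝔰(a)`. -/
def RegularWith (a g : Fin m → MvPolynomial (Fin n) K) (t : PP n) : Prop :=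
  strict tle (mulTerm t (sig tle g)) (sig tle a)

/-- The step witnessed by `g` and `t` is top: `t·lp(‾g) = lp(‾a)`. -/
def TopWith (a g : Fin m → MvPolynomial (Fin n) K) (t : PP n) : Prop :=
  t + lp ple (bar f g) = lp ple (bar f a)

/-- `a` s-reduces to `b` modulo `G` in one step. -/
def SigRedStep (G : Set (Fin m → MvPolynomial (Fin n) K))
    (a b : Fin m → MvPolynomial (Fin n) K) : Prop :=
  ∃ g t, RedStepWith f ple tle G a b g t

/-- `a` regular s-reduces to `b` modulo `G` in one step. -/
def RegRedStep (G : Set (Fin m → MvPolynomial (Fin n) K))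
    (a b : Fin m → MvPolynomial (Fin n) K) : Prop :=
  ∃ g t, RedStepWith f ple tle G a b g t ∧ RegularWith tle a g t

/-- `a` regular top s-reduces to `b` modulo `G` in one step. -/
def RegTopRedStep (G : Set (Fin m → MvPolynomial (Fin n) K))
    (a b : Fin m → MvPolynomial (Fin n) K) : Prop :=
  ∃ g t, RedStepWith f ple tle G a b g t ∧ RegularWith tle a g t ∧ TopWith f ple a g t

/-- `a` is regular s-irreducible modulo `G`. -/
def RegIrred (G : Set (Fin m → MvPolynomial (Fin n) K))
    (a : Fin m → MvPolynomial (Fin n) K) : Prop :=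
  ∀ b, ¬ RegRedStep f ple tle G a b

/-- `a` is regular top s-irreducible modulo `G`. -/
def RegTopIrred (G : Set (Fin m → MvPolynomial (Fin n) K))
    (a : Fin m → MvPolynomial (Fin n) K) : Prop :=
  ∀ b, ¬ RegTopRedStep f ple tle G a b

/-- `a` s-reduces to zero modulo `G`. -/
def SigRedZero (G : Set (Fin m → MvPolynomial (Fin n) K))
    (a : Fin m → MvPolynomial (Fin n) K) : Prop :=
  ∃ b, Relation.ReflTransGen (SigRedStep f ple tle G) a b ∧ bar f b = 0

/-- `a` regular s-reduces to zero modulo `G`. -/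
def RegRedZero (G : Set (Fin m → MvPolynomial (Fin n) K))
    (a : Fin m → MvPolynomial (Fin n) K) : Prop :=
  ∃ b, Relation.ReflTransGen (RegRedStep f ple tle G) a b ∧ bar f b = 0

/-- `G` is a signature Gröbner basis in the term `u`. -/
def IsSigGBIn (G : Set (Fin m → MvPolynomial (Fin n) K)) (u : Term n m) : Prop :=
  ∀ a : Fin m → MvPolynomial (Fin n) K, a ≠ 0 → sig tle a = u → SigRedZero f ple tle G a

/-- `G` is a signature Gröbner basis up to the term `u`. -/
def IsSigGBUpto (G : Set (Fin m → MvPolynomial (Fin n) K)) (u : Term n m) : Prop :=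
  ∀ v, strict tle v u → IsSigGBIn f ple tle G v

/-- `u` is a syzygy signature. -/
def IsSyzSig (u : Term n m) : Prop :=
  ∃ a : Fin m → MvPolynomial (Fin n) K, a ≠ 0 ∧ sig tle a = u ∧ bar f a = 0

/-- The sig-poly-pair `(𝔰(a), ‾a)` of a module element `a`. -/
noncomputable def sppOf (a : Fin m → MvPolynomial (Fin n) K) :
    Term n m × MvPolynomial (Fin n) K :=
  (sig tle a, bar f a)

/-- `x` is a sig-poly-pair. -/
def IsSPP (x : Term n m × MvPolynomial (Fin n) K) : Prop :=
  ∃ a : Fin m → MvPolynomial (Fin n) K, a ≠ 0 ∧ sppOf f tle a = x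

/-- `ro` is a rewrite order. -/
def IsRewriteOrder
    (ro : Term n m × MvPolynomial (Fin n) K → Term n m × MvPolynomial (Fin n) K → Prop) :
    Prop :=
  (∀ x, IsSPP f tle x → ro x x) ∧
  (∀ x y z, IsSPP f tle x → IsSPP f tle y → IsSPP f tle z → ro x y → ro y z → ro x z) ∧
  (∀ x y, IsSPP f tle x → IsSPP f tle y → (ro x y ∨ ro y x)) ∧
  (∀ x y, IsSPP f tle x → IsSPP f tle y → ro x y → ro y x → x.1 = y.1) ∧
  (∀ (G : Set (Fin m → MvPolynomial (Fin n) K)) (a b : Fin m → MvPolynomial (Fin n) K),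
    IsSigGBUpto f ple tle G (sig tle b) → a ∈ G → b ∈ G → a ≠ 0 → b ≠ 0 →
    termDvd (sig tle a) (sig tle b) → RegTopIrred f ple tle G b →
    ro (sppOf f tle a) (sppOf f tle b))

/-- `a` is a canonical rewriter in the term `u` w.r.t. `G` (for the rewrite order `ro`). -/
def IsCanonRewriter
    (ro : Term n m × MvPolynomial (Fin n) K → Term n m × MvPolynomial (Fin n) K → Prop)
    (G : Set (Fin m → MvPolynomial (Fin n) K)) (u : Term n m)
    (a : Fin m → MvPolynomial (Fin n) K) : Prop :=
  a ∈ G ∧ a ≠ 0 ∧ termDvd (sig tle a) u ∧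
    ∀ g ∈ G, g ≠ 0 → termDvd (sig tle g) u → ro (sppOf f tle g) (sppOf f tle a)

/-- `G` is a rewrite basis in the term `u` (for the rewrite order `ro`). -/
def IsRBIn
    (ro : Term n m × MvPolynomial (Fin n) K → Term n m × MvPolynomial (Fin n) K → Prop)
    (G : Set (Fin m → MvPolynomial (Fin n) K)) (u : Term n m) : Prop :=
  IsSyzSig f tle u ∨
    ∃ g, IsCanonRewriter f tle ro G u g ∧
      RegTopIrred f ple tle G (monomMul (1 : K) (u.1 - (sig tle g).1) g)

/-- `G` is a rewrite basis up to the term `u` (for the rewrite order `ro`). -/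
def IsRBUpto
    (ro : Term n m × MvPolynomial (Fin n) K → Term n m × MvPolynomial (Fin n) K → Prop)
    (G : Set (Fin m → MvPolynomial (Fin n) K)) (u : Term n m) : Prop :=
  ∀ v, strict tle v u → IsRBIn f ple tle ro G v

/-- The S-pair of two module elements. -/
noncomputable def spair (a b : Fin m → MvPolynomial (Fin n) K) :
    Fin m → MvPolynomial (Fin n) K :=
  monomMul ((1 : K) / lc ple (bar f a))
      (lcmPP (lp ple (bar f a)) (lp ple (bar f b)) - lp ple (bar f a)) a -
    monomMul ((1 : K) / lc ple (bar f b))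
      (lcmPP (lp ple (bar f a)) (lp ple (bar f b)) - lp ple (bar f b)) b

/-- `a` and `b` give rise to a regular S-pair. -/
def IsRegularSPair (a b : Fin m → MvPolynomial (Fin n) K) : Prop :=
  bar f a ≠ 0 ∧ bar f b ≠ 0 ∧
    mulTerm (lcmPP (lp ple (bar f a)) (lp ple (bar f b)) - lp ple (bar f a)) (sig tle a) ≠
      mulTerm (lcmPP (lp ple (bar f a)) (lp ple (bar f b)) - lp ple (bar f b)) (sig tle b)

/-- `B` is a Gröbner basis of the ideal `I` w.r.t. `ple`. -/
def IsGroebnerBasis (B : Set (MvPolynomial (Fin n) K)) (I : Ideal (MvPolynomial (Fin n) K)) :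
    Prop :=
  (∀ b ∈ B, b ∈ I) ∧ Ideal.span B = I ∧
    ∀ p ∈ I, p ≠ 0 → ∃ b ∈ B, b ≠ 0 ∧ ∃ t : PP n, lp ple p = t + lp ple b

/-- One step of ordinary polynomial reduction of `p` to `q` modulo `B`. -/
def PolyRedStep (B : Set (MvPolynomial (Fin n) K)) (p q : MvPolynomial (Fin n) K) : Prop :=
  ∃ r ∈ B, r ≠ 0 ∧ ∃ t : PP n, MvPolynomial.coeff (t + lp ple r) p ≠ 0 ∧
    q = p - MvPolynomial.monomial t (MvPolynomial.coeff (t + lp ple r) p / lc ple r) * r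

section Auxiliary

set_option linter.unusedSectionVars false

variable {f ple tle}

theorem OrdersOK.exists_ple_max (h : OrdersOK ple tle) (s : Finset (PP n)) (hs : s.Nonempty) :
    ∃ t ∈ s, ∀ u ∈ s, ple u t := by
  induction hs using Finset.Nonempty.cons_induction with
  | singleton a => exact ⟨a, by simp, by simpa using h.ple_refl a⟩
  | cons a s ha hs ih =>
    obtain ⟨t, ht, hmax⟩ := ih
    rcases h.ple_total a t with hat | hta
    · exact ⟨t, by simp [ht], by simpa [hat] using hmax⟩
    · refine ⟨a, by simp, ?_⟩
      simpa [h.ple_refl] using fun u hu => h.ple_trans _ _ _ (hmax u hu) hta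

theorem OrdersOK.exists_tle_max (h : OrdersOK ple tle) (s : Finset (Term n m))
    (hs : s.Nonempty) : ∃ t ∈ s, ∀ u ∈ s, tle u t := by
  induction hs using Finset.Nonempty.cons_induction with
  | singleton a => exact ⟨a, by simp, fun u hu => by
      rw [Finset.mem_singleton.1 hu]; exact h.tle_refl a⟩
  | cons a s ha hs ih =>
    obtain ⟨t, ht, hmax⟩ := ih
    rcases h.tle_total a t with hat | hta
    · refine ⟨t, Finset.mem_cons_of_mem ht, fun u hu => ?_⟩
      rcases Finset.mem_cons.1 hu with rfl | hu
      exacts [hat, hmax u hu]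
    · refine ⟨a, Finset.mem_cons_self a s, fun u hu => ?_⟩
      rcases Finset.mem_cons.1 hu with rfl | hu
      exacts [h.tle_refl _, h.tle_trans _ _ _ (hmax u hu) hta]

theorem lp_spec (h : OrdersOK ple tle) {p : MvPolynomial (Fin n) K} (hp : p ≠ 0) :
    MvPolynomial.coeff (lp ple p) p ≠ 0 ∧
      ∀ s, MvPolynomial.coeff s p ≠ 0 → ple s (lp ple p) := by
  have hex : ∃ t, MvPolynomial.coeff t p ≠ 0 ∧
      ∀ s, MvPolynomial.coeff s p ≠ 0 → ple s t := by
    obtain ⟨t, ht, hmax⟩ := h.exists_ple_max p.support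
      (Finset.nonempty_iff_ne_empty.2 fun h0 => hp (MvPolynomial.support_eq_empty.1 h0))
    exact ⟨t, MvPolynomial.mem_support_iff.1 ht,
      fun s hs => hmax s (MvPolynomial.mem_support_iff.2 hs)⟩
  rw [lp, dif_pos hex]
  exact hex.choose_spec

theorem sig_spec (h : OrdersOK ple tle) {a : Fin m → MvPolynomial (Fin n) K} (ha : a ≠ 0) :
    coeffM a (sig tle a) ≠ 0 ∧ ∀ v, coeffM a v ≠ 0 → tle v (sig tle a) := by
  classical
  have hex : ∃ u, coeffM a u ≠ 0 ∧ ∀ v, coeffM a v ≠ 0 → tle v u := by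
    let s : Finset (Term n m) := (Finset.univ.biUnion fun i => (a i).support) ×ˢ Finset.univ
    have hmem : ∀ v, coeffM a v ≠ 0 → v ∈ s.filter fun v => coeffM a v ≠ 0 := fun v hv => by
      simp only [Finset.mem_filter, s, Finset.mem_product, Finset.mem_biUnion, Finset.mem_univ,
        true_and, and_true, MvPolynomial.mem_support_iff]
      exact ⟨⟨v.2, hv⟩, hv⟩
    obtain ⟨i, hi⟩ := Function.ne_iff.1 ha
    obtain ⟨t, ht⟩ := MvPolynomial.ne_zero_iff.1 hi
    obtain ⟨u, hu, hmax⟩ := h.exists_tle_max (s.filter fun v => coeffM a v ≠ 0)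
      ⟨(t, i), hmem (t, i) ht⟩
    exact ⟨u, (Finset.mem_filter.1 hu).2, fun v hv => hmax v (hmem v hv)⟩
  rw [sig, dif_pos hex]
  exact hex.choose_spec

theorem bar_sub (a b : Fin m → MvPolynomial (Fin n) K) :
    bar f (a - b) = bar f a - bar f b := by
  simp [bar, sub_mul]

theorem bar_monomMul (c : K) (t : PP n) (a : Fin m → MvPolynomial (Fin n) K) :
    bar f (monomMul c t a) = MvPolynomial.monomial t c * bar f a := by
  simp [bar, monomMul, Finset.mul_sum, mul_assoc]

theorem ne_zero_of_bar_ne_zero {a : Fin m → MvPolynomial (Fin n) K} (ha : bar f a ≠ 0) :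
    a ≠ 0 := by
  rintro rfl
  simp [bar] at ha

theorem exists_of_coeff_monomial_mul_ne_zero {c : K} {t s : PP n} {p : MvPolynomial (Fin n) K}
    (hs : MvPolynomial.coeff s (MvPolynomial.monomial t c * p) ≠ 0) :
    ∃ u, s = t + u ∧ MvPolynomial.coeff u p ≠ 0 := by
  rw [MvPolynomial.coeff_monomial_mul'] at hs
  split_ifs at hs with hle
  · exact ⟨s - t, (add_tsub_cancel_of_le hle).symm, right_ne_zero_of_mul hs⟩
  · exact absurd rfl hs

theorem coeffM_sub (a b : Fin m → MvPolynomial (Fin n) K) (u : Term n m) :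
    coeffM (a - b) u = coeffM a u - coeffM b u := by
  simp [coeffM]

theorem coeffM_monomMul (c : K) (t : PP n) (a : Fin m → MvPolynomial (Fin n) K) (u : Term n m) :
    coeffM (monomMul c t a) (mulTerm t u) = c * coeffM a u := by
  simp [coeffM, monomMul, mulTerm, MvPolynomial.coeff_monomial_mul]

theorem mulTerm_mulTerm (s t : PP n) (u : Term n m) :
    mulTerm s (mulTerm t u) = mulTerm (s + t) u := by
  simp [mulTerm, add_assoc]

theorem mulTerm_injective (t : PP n) : Function.Injective (mulTerm (m := m) t) := by
  intro u v huv
  simp only [mulTerm, Prod.mk.injEq, add_right_inj] at huv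
  exact Prod.ext huv.1 huv.2

theorem exists_of_coeffM_monomMul_ne_zero {c : K} {t : PP n}
    {a : Fin m → MvPolynomial (Fin n) K} {v : Term n m} (hv : coeffM (monomMul c t a) v ≠ 0) :
    ∃ u, v = mulTerm t u ∧ coeffM a u ≠ 0 := by
  obtain ⟨u, hu, hne⟩ := exists_of_coeff_monomial_mul_ne_zero hv
  exact ⟨(u, v.2), Prod.ext hu rfl, hne⟩

theorem tle_of_coeffM_monomMul_ne_zero (h : OrdersOK ple tle) {c : K} {t : PP n}
    {a : Fin m → MvPolynomial (Fin n) K} (ha : a ≠ 0) {v : Term n m}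
    (hv : coeffM (monomMul c t a) v ≠ 0) : tle v (mulTerm t (sig tle a)) := by
  obtain ⟨u, rfl, hu⟩ := exists_of_coeffM_monomMul_ne_zero hv
  exact h.tle_mul _ _ _ ((sig_spec h ha).2 u hu)

theorem ple_of_coeff_monomial_mul_ne_zero (h : OrdersOK ple tle) {c : K} {t s : PP n}
    {p : MvPolynomial (Fin n) K} (hp : p ≠ 0)
    (hs : MvPolynomial.coeff s (MvPolynomial.monomial t c * p) ≠ 0) :
    ple s (t + lp ple p) := by
  obtain ⟨u, rfl, hu⟩ := exists_of_coeff_monomial_mul_ne_zero hs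
  exact h.ple_mul _ _ _ ((lp_spec h hp).2 u hu)

theorem sig_monomMul (h : OrdersOK ple tle) {c : K} (hc : c ≠ 0) (t : PP n)
    {a : Fin m → MvPolynomial (Fin n) K} (ha : a ≠ 0) :
    monomMul c t a ≠ 0 ∧ sig tle (monomMul c t a) = mulTerm t (sig tle a) := by
  have hne : coeffM (monomMul c t a) (mulTerm t (sig tle a)) ≠ 0 := by
    rw [coeffM_monomMul]
    exact mul_ne_zero hc (sig_spec h ha).1
  have h0 : monomMul c t a ≠ 0 := fun h0 => hne (by simp [h0, coeffM])
  exact ⟨h0, h.tle_antisymm _ _ (tle_of_coeffM_monomMul_ne_zero h ha (sig_spec h h0).1)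
    ((sig_spec h h0).2 _ hne)⟩

theorem tle_sig_sub (h : OrdersOK ple tle) {a b : Fin m → MvPolynomial (Fin n) K}
    (ha : a ≠ 0) (hb : b ≠ 0) (hab : sig tle a ≠ sig tle b) :
    tle (sig tle a) (sig tle (a - b)) ∧ tle (sig tle b) (sig tle (a - b)) := by
  have hsub : a - b ≠ 0 := fun h0 => hab (by rw [sub_eq_zero.1 h0])
  rcases h.tle_total (sig tle a) (sig tle b) with hle | hle
  · have h0 : coeffM a (sig tle b) = 0 := by
      by_contra hne
      exact hab (h.tle_antisymm _ _ hle ((sig_spec h ha).2 _ hne))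
    have hb' : tle (sig tle b) (sig tle (a - b)) := (sig_spec h hsub).2 _ (by
      rw [coeffM_sub, h0, zero_sub]
      exact neg_ne_zero.2 (sig_spec h hb).1)
    exact ⟨h.tle_trans _ _ _ hle hb', hb'⟩
  · have h0 : coeffM b (sig tle a) = 0 := by
      by_contra hne
      exact hab (h.tle_antisymm _ _ ((sig_spec h hb).2 _ hne) hle)
    have ha' : tle (sig tle a) (sig tle (a - b)) := (sig_spec h hsub).2 _ (by
      rw [coeffM_sub, h0, sub_zero]
      exact (sig_spec h ha).1)
    exact ⟨ha', h.tle_trans _ _ _ hle ha'⟩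

/-- A monomial multiple of `a` whose signature does not exceed `u` can be subtracted
without exceeding `u`. -/
theorem tle_of_coeffM_sub_monomMul_ne_zero (h : OrdersOK ple tle) {c : K} {t : PP n}
    {a b : Fin m → MvPolynomial (Fin n) K} (ha : a ≠ 0) (hb : b ≠ 0) {u v : Term n m}
    (hau : tle (sig tle a) u) (hbu : tle (mulTerm t (sig tle b)) u)
    (hv : coeffM (a - monomMul c t b) v ≠ 0) : tle v u := by
  rw [coeffM_sub] at hv
  by_cases h0 : coeffM a v = 0
  · rw [h0, zero_sub] at hv
    exact h.tle_trans _ _ _ (tle_of_coeffM_monomMul_ne_zero h hb (neg_ne_zero.1 hv)) hbu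
  · exact h.tle_trans _ _ _ ((sig_spec h ha).2 v h0) hau

/-- If `b` s-reduces to zero, then its leading power-product is eliminated by some step whose
signature is at most that of `b`. -/
theorem exists_top_reducer (h : OrdersOK ple tle) {G : Set (Fin m → MvPolynomial (Fin n) K)}
    {q : PP n} {u : Term n m} {b : Fin m → MvPolynomial (Fin n) K}
    (hred : SigRedZero f ple tle G b) (hq : MvPolynomial.coeff q (bar f b) ≠ 0)
    (hmax : ∀ s, MvPolynomial.coeff s (bar f b) ≠ 0 → ple s q) (hu : tle (sig tle b) u) :
    ∃ g ∈ G, bar f g ≠ 0 ∧ ∃ t, t + lp ple (bar f g) = q ∧ tle (mulTerm t (sig tle g)) u := by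
  obtain ⟨z, hbz, hz⟩ := hred
  induction hbz using Relation.ReflTransGen.head_induction_on with
  | refl => simp [hz] at hq
  | @head x _ hstep _ ih =>
    obtain ⟨g, t, hg, hg0, hc, rfl, hsig⟩ := hstep
    by_cases hqt : t + lp ple (bar f g) = q
    · exact ⟨g, hg, hg0, t, hqt, h.tle_trans _ _ _ hsig hu⟩
    have hlt : ple (t + lp ple (bar f g)) q := hmax _ hc
    set c := MvPolynomial.coeff (t + lp ple (bar f g)) (bar f x) / lc ple (bar f g)
    have hq' : MvPolynomial.coeff q (bar f (x - monomMul c t g)) ≠ 0 := by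
      have h0 : MvPolynomial.coeff q (MvPolynomial.monomial t c * bar f g) = 0 := by
        by_contra hne
        exact hqt (h.ple_antisymm _ _ hlt (ple_of_coeff_monomial_mul_ne_zero h hg0 hne))
      rwa [bar_sub, bar_monomMul, MvPolynomial.coeff_sub, h0, sub_zero]
    have hy0 : x - monomMul c t g ≠ 0 := ne_zero_of_bar_ne_zero (f := f) fun h0 => hq' (by simp [h0])
    refine ih hq' (fun s hs => ?_) ?_
    · rw [bar_sub, bar_monomMul, MvPolynomial.coeff_sub] at hs
      by_cases h0 : MvPolynomial.coeff s (bar f x) = 0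
      · rw [h0, zero_sub] at hs
        exact h.ple_trans _ _ _ (ple_of_coeff_monomial_mul_ne_zero h hg0 (neg_ne_zero.1 hs)) hlt
      · exact hmax s h0
    · exact tle_of_coeffM_sub_monomMul_ne_zero h
        (ne_zero_of_bar_ne_zero (f := f) fun h0 => hq (by simp [h0])) (ne_zero_of_bar_ne_zero hg0) hu
        (h.tle_trans _ _ _ hsig hu) (sig_spec h hy0).1

theorem OrdersOK.strict_mulTerm (h : OrdersOK ple tle) {s t : PP n} (hst : ple s t)
    (hne : s ≠ t) (u : Term n m) : strict tle (mulTerm s u) (mulTerm t u) := by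
  refine ⟨h.tle_compat _ _ _ _ ?_ le_rfl, fun heq => hne ?_⟩
  · simpa [add_comm] using h.ple_mul u.1 s t hst
  · simpa [mulTerm] using heq

theorem OrdersOK.strict_of_tle_of_strict (h : OrdersOK ple tle) {u v w : Term n m}
    (huv : tle u v) (hvw : strict tle v w) : strict tle u w :=
  ⟨h.tle_trans _ _ _ huv hvw.1, fun heq => hvw.2 (h.tle_antisymm _ _ hvw.1 (heq ▸ huv))⟩

theorem not_regIrred_of_top (h : OrdersOK ple tle) {G : Set (Fin m → MvPolynomial (Fin n) K)}
    {a g : Fin m → MvPolynomial (Fin n) K} (ha : bar f a ≠ 0) (hgG : g ∈ G) (hg : bar f g ≠ 0)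
    {t : PP n} (ht : t + lp ple (bar f g) = lp ple (bar f a))
    (hs : strict tle (mulTerm t (sig tle g)) (sig tle a)) : ¬ RegIrred f ple tle G a :=
  fun hirr => hirr _ ⟨g, t, ⟨hgG, hg, by rw [ht]; exact (lp_spec h ha).1, rfl, hs.1⟩, hs⟩

/-- Divisibility of both the signature and the leading power-product of a regular irreducible
element happens with the same cofactor. -/
theorem cofactor_eq (h : OrdersOK ple tle) {G : Set (Fin m → MvPolynomial (Fin n) K)}
    {a g : Fin m → MvPolynomial (Fin n) K} (ha : bar f a ≠ 0) (hg : bar f g ≠ 0) (hgG : g ∈ G)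
    (hirr : RegIrred f ple tle G a) (hgb : IsSigGBUpto f ple tle G (sig tle a)) {s t : PP n}
    (hs : sig tle a = mulTerm s (sig tle g))
    (ht : lp ple (bar f a) = t + lp ple (bar f g)) : s = t := by
  by_contra hne
  have ha0 := ne_zero_of_bar_ne_zero ha
  have hg0 := ne_zero_of_bar_ne_zero hg
  rcases h.ple_total t s with hts | hst
  · exact not_regIrred_of_top h ha hgG hg ht.symm
      (hs ▸ h.strict_mulTerm hts (Ne.symm hne) _) hirr
  set c := coeffM a (sig tle a) / coeffM g (sig tle g) with hc
  set b := a - monomMul c s g with hb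
  have hlow : ∀ r, MvPolynomial.coeff r (MvPolynomial.monomial s c * bar f g) ≠ 0 →
      strict ple r (lp ple (bar f a)) := by
    intro r hr
    have hle := ple_of_coeff_monomial_mul_ne_zero h hg hr
    have hlt : ple (s + lp ple (bar f g)) (lp ple (bar f a)) := by
      rw [ht, add_comm s, add_comm t]
      exact h.ple_mul _ _ _ hst
    refine ⟨h.ple_trans _ _ _ hle hlt, ?_⟩
    rintro rfl
    exact hne (add_right_cancel ((h.ple_antisymm _ _ hle hlt).symm.trans ht))
  have hq : MvPolynomial.coeff (lp ple (bar f a)) (bar f b) ≠ 0 := by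
    have h0 : MvPolynomial.coeff (lp ple (bar f a)) (MvPolynomial.monomial s c * bar f g) = 0 := by
      by_contra h0
      exact (hlow _ h0).2 rfl
    rw [hb, bar_sub, bar_monomMul, MvPolynomial.coeff_sub, h0, sub_zero]
    exact (lp_spec h ha).1
  have hmax : ∀ r, MvPolynomial.coeff r (bar f b) ≠ 0 → ple r (lp ple (bar f a)) := by
    intro r hr
    rw [hb, bar_sub, bar_monomMul, MvPolynomial.coeff_sub] at hr
    by_cases h0 : MvPolynomial.coeff r (bar f a) = 0
    · rw [h0, zero_sub] at hr
      exact (hlow r (neg_ne_zero.1 hr)).1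
    · exact (lp_spec h ha).2 r h0
  have hb0 : b ≠ 0 := ne_zero_of_bar_ne_zero (f := f) fun h0 => hq (by simp [h0])
  have hbs : strict tle (sig tle b) (sig tle a) := by
    refine ⟨tle_of_coeffM_sub_monomMul_ne_zero h ha0 hg0 (h.tle_refl _)
      (hs ▸ h.tle_refl _) (sig_spec h hb0).1, fun heq => (sig_spec h hb0).1 ?_⟩
    rw [heq, hb, coeffM_sub]
    nth_rewrite 2 [hs]
    rw [coeffM_monomMul, hc, div_mul_cancel₀ _ (sig_spec h hg0).1, sub_self]
  obtain ⟨r, hrG, hr, t', ht', hsig⟩ :=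
    exists_top_reducer h (hgb _ hbs b hb0 rfl) hq hmax (h.tle_refl _)
  exact not_regIrred_of_top h ha hrG hr ht' (h.strict_of_tle_of_strict hsig hbs) hirr

theorem OrdersOK.tle_of_mulTerm (h : OrdersOK ple tle) {t : PP n} {u v : Term n m}
    (huv : tle (mulTerm t u) (mulTerm t v)) : tle u v := by
  rcases h.tle_total u v with hle | hle
  · exact hle
  · rw [mulTerm_injective t (h.tle_antisymm _ _ huv (h.tle_mul t _ _ hle))]
    exact h.tle_refl v

/-- Pairs `(u, t)` of a term and a power-product, to be ordered by their ratios `u / t`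
instead of componentwise. -/
def RatioPair (n m : ℕ) : Type := Term n m × PP n

/-- The preorder comparing the ratios `u / t` of pairs `(u, t)`. -/
abbrev OrdersOK.ratioPreorder (h : OrdersOK ple tle) : Preorder (RatioPair n m) where
  le x y := tle (mulTerm y.2 x.1) (mulTerm x.2 y.1)
  le_refl _ := h.tle_refl _
  le_trans x y z hxy hyz := by
    refine h.tle_of_mulTerm (t := y.2) (h.tle_trans _ (mulTerm z.2 (mulTerm x.2 y.1)) _ ?_ ?_)
    · have := h.tle_mul z.2 _ _ hxy
      rwa [mulTerm_mulTerm, add_comm, ← mulTerm_mulTerm] at this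
    · have := h.tle_mul x.2 _ _ hyz
      rwa [mulTerm_mulTerm, add_comm, ← mulTerm_mulTerm, mulTerm_mulTerm x.2 y.2, add_comm x.2,
        ← mulTerm_mulTerm] at this

theorem le_lcmPP_left (s t : PP n) : s ≤ lcmPP s t := fun i => by simp [lcmPP]

theorem le_lcmPP_right (s t : PP n) : t ≤ lcmPP s t := fun i => by simp [lcmPP]

theorem tle_sig_spair (h : OrdersOK ple tle) {a b : Fin m → MvPolynomial (Fin n) K}
    (hab : IsRegularSPair f ple tle a b) :
    tle (mulTerm (lcmPP (lp ple (bar f a)) (lp ple (bar f b)) - lp ple (bar f a)) (sig tle a))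
        (sig tle (spair f ple a b)) ∧
      tle (mulTerm (lcmPP (lp ple (bar f a)) (lp ple (bar f b)) - lp ple (bar f b)) (sig tle b))
        (sig tle (spair f ple a b)) := by
  obtain ⟨ha, hb, hne⟩ := hab
  obtain ⟨ha0, has⟩ := sig_monomMul h (one_div_ne_zero (lp_spec h ha).1)
    (lcmPP (lp ple (bar f a)) (lp ple (bar f b)) - lp ple (bar f a)) (ne_zero_of_bar_ne_zero ha)
  obtain ⟨hb0, hbs⟩ := sig_monomMul h (one_div_ne_zero (lp_spec h hb).1)
    (lcmPP (lp ple (bar f a)) (lp ple (bar f b)) - lp ple (bar f b)) (ne_zero_of_bar_ne_zero hb)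
  have key := tle_sig_sub h ha0 hb0 (by rwa [has, hbs])
  rwa [has, hbs] at key

theorem lp_spair_strict (h : OrdersOK ple tle) {a b : Fin m → MvPolynomial (Fin n) K}
    (ha : bar f a ≠ 0) (hb : bar f b ≠ 0) (hab : bar f (spair f ple a b) ≠ 0) :
    strict ple (lp ple (bar f (spair f ple a b)))
      (lcmPP (lp ple (bar f a)) (lp ple (bar f b))) := by
  have hcoeff := (lp_spec h hab).1
  set q := lp ple (bar f (spair f ple a b))
  rw [spair, bar_sub, bar_monomMul, bar_monomMul, MvPolynomial.coeff_sub] at hcoeff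
  have hla := tsub_add_cancel_of_le (le_lcmPP_left (lp ple (bar f a)) (lp ple (bar f b)))
  have hlb := tsub_add_cancel_of_le (le_lcmPP_right (lp ple (bar f a)) (lp ple (bar f b)))
  set l := lcmPP (lp ple (bar f a)) (lp ple (bar f b))
  constructor
  · by_cases h0 : MvPolynomial.coeff q (MvPolynomial.monomial (l - lp ple (bar f a))
        (1 / lc ple (bar f a)) * bar f a) = 0
    · rw [h0, zero_sub] at hcoeff
      exact hlb ▸ ple_of_coeff_monomial_mul_ne_zero h hb (neg_ne_zero.1 hcoeff)
    · exact hla ▸ ple_of_coeff_monomial_mul_ne_zero h ha h0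
  · intro hq
    apply hcoeff
    rw [hq]
    nth_rewrite 1 [← hla]
    nth_rewrite 3 [← hlb]
    rw [MvPolynomial.coeff_monomial_mul, MvPolynomial.coeff_monomial_mul]
    change 1 / lc ple (bar f a) * lc ple (bar f a) - 1 / lc ple (bar f b) * lc ple (bar f b) = 0
    have hca : lc ple (bar f a) ≠ 0 := (lp_spec h ha).1
    have hcb : lc ple (bar f b) ≠ 0 := (lp_spec h hb).1
    rw [one_div_mul_cancel hca, one_div_mul_cancel hcb, sub_self]

/-- If `u` is at least `d ⊗ v` and `p` is smaller than `d·q`, then the ratio `u / p`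
exceeds the ratio `v / q`. -/
theorem OrdersOK.ratio_lt (h : OrdersOK ple tle) {u v : Term n m} {p q d : PP n}
    (huv : tle (mulTerm d v) u) (hpq : strict ple p (d + q)) :
    h.ratioPreorder.lt (v, q) (u, p) := by
  have hnot : ¬ tle (mulTerm q u) (mulTerm p v) := by
    intro hle
    have hle' := h.tle_mul d _ _ hle
    rw [mulTerm_mulTerm, mulTerm_mulTerm d p, add_comm d p, ← mulTerm_mulTerm p] at hle'
    have hle'' := h.tle_trans _ _ _ hle' (h.tle_mul p _ _ huv)
    have hs := h.strict_mulTerm hpq.1 hpq.2 u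
    exact hs.2 (h.tle_antisymm _ _ hs.1 hle'')
  let _ := h.ratioPreorder
  exact lt_of_le_not_ge ((h.tle_total _ _).resolve_right hnot) hnot

/-- A sequence with values in finitely many classes cannot be infinite if the members of each
class are determined up to finitely many by the members of the smaller classes. -/
theorem false_of_finite_range {β : Type*} [PartialOrder β] (ρ : ℕ → β)
    (hρ : (Set.range ρ).Finite) (child : Set ℕ → Set ℕ)
    (hfin : ∀ L : Set ℕ, L.Finite → (child L).Finite)
    (hchild : ∀ i, i ∈ child {j | ρ j < ρ i}) : False := by
  have hfiber : ∀ b ∈ Set.range ρ, (ρ ⁻¹' {b}).Finite := by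
    intro b hb
    refine (hρ.wellFoundedOn (r := ((· < ·) : β → β → Prop))).induction
      (P := fun b => (ρ ⁻¹' {b}).Finite) hb fun b hb ih => ?_
    have hlow : {j | ρ j < b}.Finite := by
      refine (hρ.biUnion (t := fun c => {j | ρ j = c ∧ c < b}) fun c hc => ?_).subset
        fun j hj => Set.mem_biUnion (Set.mem_range_self j) ⟨rfl, hj⟩
      by_cases hcb : c < b
      · exact (ih c hc hcb).subset fun j hj => hj.1
      · simp [hcb]
    refine (hfin _ hlow).subset fun i hi => ?_
    rw [← (hi : ρ i = b)]
    exact hchild i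
  refine Set.infinite_univ (α := ℕ) ((hρ.biUnion hfiber).subset fun i _ => ?_)
  exact Set.mem_biUnion (Set.mem_range_self i) rfl

theorem wellQuasiOrdered_termDvd_prod :
    WellQuasiOrdered fun x y : Term n m × PP n => termDvd x.1 y.1 ∧ x.2 ≤ y.2 := by
  have hpp : WellQuasiOrdered ((· ≤ ·) : PP n × PP n → PP n × PP n → Prop) :=
    wellQuasiOrdered_le
  have heq : WellQuasiOrdered ((· = ·) : Fin m → Fin m → Prop) := Finite.wellQuasiOrdered _
  intro x
  obtain ⟨i, j, hij, ⟨h₁, h₂⟩, h₃⟩ := hpp.prod heq fun i => (((x i).1.1, (x i).2), (x i).1.2)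
  exact ⟨i, j, hij, ⟨(x j).1.1 - (x i).1.1, Prod.ext (tsub_add_cancel_of_le h₁).symm h₃.symm⟩, h₂⟩

/-- If divisibility between members of a sequence forces equality of classes, then there are
only finitely many classes. -/
theorem finite_range_of_wellQuasiOrdered {α β : Type*} {r : α → α → Prop}
    (hr : WellQuasiOrdered r) (x : ℕ → α) (ρ : ℕ → β)
    (h : ∀ i j, i < j → r (x i) (x j) → ρ i = ρ j) : (Set.range ρ).Finite := by
  by_contra hinf
  have hinf' : {j | ∀ i < j, ρ i ≠ ρ j}.Infinite := by
    refine Set.Infinite.of_image ρ (Set.Infinite.mono ?_ hinf)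
    rintro _ ⟨j, rfl⟩
    induction j using Nat.strong_induction_on with
    | _ j ih =>
    by_cases hj : ∀ i < j, ρ i ≠ ρ j
    · exact ⟨j, hj, rfl⟩
    · push Not at hj
      obtain ⟨i, hi, heq⟩ := hj
      exact heq ▸ ih i hi
  obtain ⟨i, j, hij, hdvd⟩ := hr (x ∘ Nat.nth fun j => ∀ i < j, ρ i ≠ ρ j)
  have hlt := Nat.nth_strictMono hinf' hij
  exact Nat.nth_mem_of_infinite hinf' j _ hlt (h _ _ hlt hdvd)

end Auxiliary

/-- termination of the rewrite-basis algorithm: there is no infinite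
sequence of module elements with the listed properties. -/
theorem rb_termination (hord : OrdersOK ple tle) :
    ¬ ∃ seq : ℕ → (Fin m → MvPolynomial (Fin n) K),
      (∀ i : ℕ, bar f (seq i) ≠ 0) ∧
      (∀ i j : ℕ, i < j → strict tle (sig tle (seq i)) (sig tle (seq j))) ∧
      (∀ i : ℕ,
        (∃ j : Fin m, f j ≠ 0 ∧ sig tle (seq i) = ((0 : PP n), j) ∧
          ple (lp ple (bar f (seq i))) (lp ple (f j))) ∨
        (∃ j k : ℕ, IsRegularSPair f ple tle (seq j) (seq k) ∧
          bar f (spair f ple (seq j) (seq k)) ≠ 0 ∧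
          sig tle (seq i) = sig tle (spair f ple (seq j) (seq k)) ∧
          ple (lp ple (bar f (seq i))) (lp ple (bar f (spair f ple (seq j) (seq k)))))) ∧
      (∀ i : ℕ, RegIrred f ple tle (seq '' Set.Iio i) (seq i)) ∧
      (∀ i : ℕ, IsSigGBUpto f ple tle (seq '' Set.Iio i) (sig tle (seq i))) := by
  rintro ⟨seq, hne, hsig, horig, hirr, hgb⟩
  let _ : Preorder (RatioPair n m) := hord.ratioPreorder
  let x : ℕ → Term n m × PP n := fun i => (sig tle (seq i), lp ple (bar f (seq i)))
  let ρ : ℕ → Antisymmetrization (RatioPair n m) (· ≤ ·) :=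
    fun i => toAntisymmetrization (· ≤ ·) (x i : RatioPair n m)
  have hρ : (Set.range ρ).Finite := by
    refine finite_range_of_wellQuasiOrdered wellQuasiOrdered_termDvd_prod x ρ ?_
    rintro i j hij ⟨⟨s, hs⟩, hle⟩
    have ht := (tsub_add_cancel_of_le hle).symm
    have hst := cofactor_eq hord (hne j) (hne i) (Set.mem_image_of_mem seq hij) (hirr j) (hgb j)
      hs ht
    have heq : mulTerm (x j).2 (x i).1 = mulTerm (x i).2 (x j).1 := by
      rw [hs, ht, ← hst, mulTerm_mulTerm, add_comm]
    refine Quotient.sound ⟨?_, ?_⟩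
    · change tle (mulTerm (x j).2 (x i).1) (mulTerm (x i).2 (x j).1)
      exact heq ▸ hord.tle_refl _
    · change tle (mulTerm (x i).2 (x j).1) (mulTerm (x j).2 (x i).1)
      exact heq ▸ hord.tle_refl _
  have hinj : Function.Injective fun i => sig tle (seq i) := by
    intro i j hij
    rcases lt_trichotomy i j with hlt | heq | hlt
    · exact absurd hij (hsig i j hlt).2
    · exact heq
    · exact absurd hij.symm (hsig j i hlt).2
  refine false_of_finite_range ρ hρ
    (fun L => (fun i => sig tle (seq i)) ⁻¹' (Set.range (fun e : Fin m => ((0 : PP n), e)) ∪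
      Set.image2 (fun j k => sig tle (spair f ple (seq j) (seq k))) L L))
    (fun L hL => ((Set.finite_range _).union (hL.image2 _ hL)).preimage hinj.injOn) fun i => ?_
  rcases horig i with ⟨e, -, he, -⟩ | ⟨j, k, hreg, hbar, hs, hp⟩
  · exact Or.inl ⟨e, he.symm⟩
  · have hlcm := lp_spair_strict hord hreg.1 hreg.2.1 hbar
    have hp' : strict ple (lp ple (bar f (seq i)))
        (lcmPP (lp ple (bar f (seq j))) (lp ple (bar f (seq k)))) :=
      ⟨hord.ple_trans _ _ _ hp hlcm.1, fun heq =>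
        hlcm.2 (hord.ple_antisymm _ _ hlcm.1 (heq ▸ hp))⟩
    obtain ⟨hj, hk⟩ := tle_sig_spair hord hreg
    rw [← hs] at hj hk
    refine Or.inr ⟨j, ?_, k, ?_, hs.symm⟩
    · exact toAntisymmetrization_lt_toAntisymmetrization_iff.2 (hord.ratio_lt hj
        (by rwa [tsub_add_cancel_of_le (le_lcmPP_left _ _)]))
    · exact toAntisymmetrization_lt_toAntisymmetrization_iff.2 (hord.ratio_lt hk
        (by rwa [tsub_add_cancel_of_le (le_lcmPP_right _ _)]))

end

end SigGB
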